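/- (Conservativeness) Let p be a good heat kernel for L^κ. Then for all t > 0 and x ∈ ℝ^d, ∫_{ℝ^d} p(t,x,y) dy = 1. -/

import Mathlib

open MeasureTheory Filter Set

attribute [local instance] Classical.propDecidable

noncomputable def Phi (φ : ℝ → ℝ) (r : ℝ) : ℝ :=
  if r ≤ 1 then r ^ 2 / (2 * ∫ s in Set.Ioo (0:ℝ) r, s / φ s)
  else (1 / (2 * ∫ s in Set.Ioo (0:ℝ) 1, s / φ s)) * r ^ 2

noncomputable def theta (d : ℕ) (φ : ℝ → ℝ) (b β : ℝ) (r : ℝ) : ℝ :=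
  if r ≤ 1 then 1 / (r ^ d * Phi φ r)
  else if β < 1 then Real.exp (-b * r ^ β)
  else r ^ (-(d : ℝ) - 1) * Real.exp (-(b / 5) * r)

noncomputable def Gfun (d : ℕ) (φ : ℝ → ℝ) (b β : ℝ) (Φinv : ℝ → ℝ)
    (t : ℝ) (x : EuclideanSpace ℝ (Fin d)) : ℝ :=
  if x = 0 then 1 / (t * Φinv t ^ d)
  else min (1 / (t * Φinv t ^ d)) (theta d φ b β ‖x‖)

noncomputable def Gtil (d : ℕ) (φ : ℝ → ℝ) (Φinv : ℝ → ℝ)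
    (t : ℝ) (x : EuclideanSpace ℝ (Fin d)) : ℝ :=
  if x = 0 then 1 / (t * Φinv t ^ d)
  else min (1 / (t * Φinv t ^ d)) (1 / (‖x‖ ^ d * Phi φ ‖x‖))

noncomputable def Leps (d : ℕ)
    (κ : EuclideanSpace ℝ (Fin d) → EuclideanSpace ℝ (Fin d) → ℝ) (J : ℝ → ℝ)
    (ε : ℝ) (f : EuclideanSpace ℝ (Fin d) → ℝ) (x : EuclideanSpace ℝ (Fin d)) : ℝ :=
  ∫ z in {z : EuclideanSpace ℝ (Fin d) | ε < ‖z‖}, (f (x + z) - f x) * (κ x z * J ‖z‖)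

structure PhiInvSpec (φ Φinv : ℝ → ℝ) : Prop where
  pos : ∀ t : ℝ, 0 < t → 0 < Φinv t
  right_inv : ∀ t : ℝ, 0 < t → Phi φ (Φinv t) = t
  left_inv : ∀ r : ℝ, 0 < r → Φinv (Phi φ r) = r

structure HKAssumptions (d : ℕ) (φ J : ℝ → ℝ) (a₁ α₁ C₀ a b β : ℝ)
    (κ : EuclideanSpace ℝ (Fin d) → EuclideanSpace ℝ (Fin d) → ℝ)
    (κ₀ κ₁ κ₂ δ : ℝ) : Prop where
  hd : 1 ≤ d
  φ_cont : ContinuousOn φ (Set.Icc 0 1)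
  φ_mono : StrictMonoOn φ (Set.Icc 0 1)
  φ_zero : φ 0 = 0
  a₁_pos : 0 < a₁
  α₁_pos : 0 < α₁
  α₁_le : α₁ ≤ 2
  hLS : ∀ r R : ℝ, 0 < r → r ≤ R → R ≤ 1 → a₁ * (R / r) ^ α₁ ≤ φ R / φ r
  hI : MeasureTheory.IntegrableOn (fun s => s / φ s) (Set.Ioo (0:ℝ) 1)
  hC₀ : C₀ = ∫ s in Set.Ioo (0:ℝ) 1, s / φ s
  J_pos : ∀ r : ℝ, 0 < r → 0 < J r
  J_cont : ContinuousOn J (Set.Ioi 0)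
  J_anti : AntitoneOn J (Set.Ioi 0)
  J_diff : ∀ r : ℝ, 0 < r → DifferentiableAt ℝ J r
  ha : 1 ≤ a
  hb : 0 < b
  β_pos : 0 < β
  β_le : β ≤ 1
  hJ1_low : ∀ r : ℝ, 0 < r → r ≤ 1 → a⁻¹ / (r ^ d * φ r) ≤ J r
  hJ1_up : ∀ r : ℝ, 0 < r → r ≤ 1 → J r ≤ a / (r ^ d * φ r)
  hJ1_exp : ∀ r : ℝ, 1 < r → J r ≤ a * Real.exp (-b * r ^ β)
  hJ2 : AntitoneOn (fun r => -(deriv J r) / r) (Set.Ioi 0)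
  κ_meas : Measurable (Function.uncurry κ)
  κ₀_pos : 0 < κ₀
  κ₁_pos : 0 < κ₁
  κ₂_pos : 0 < κ₂
  δ_pos : 0 < δ
  δ_lt : δ < 1
  κ_low : ∀ x z, κ₀ ≤ κ x z
  κ_up : ∀ x z, κ x z ≤ κ₁
  κ_sym : ∀ x z, κ x z = κ x (-z)
  κ_holder : ∀ x y z, |κ x z - κ y z| ≤ κ₂ * ‖x - y‖ ^ δ

structure GoodHeatKernel (d : ℕ) (φ J : ℝ → ℝ) (b β : ℝ) (Φinv : ℝ → ℝ)
    (κ : EuclideanSpace ℝ (Fin d) → EuclideanSpace ℝ (Fin d) → ℝ)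
    (p : ℝ → EuclideanSpace ℝ (Fin d) → EuclideanSpace ℝ (Fin d) → ℝ) : Prop where
  cont : ContinuousOn
      (fun q : ℝ × EuclideanSpace ℝ (Fin d) × EuclideanSpace ℝ (Fin d) => p q.1 q.2.1 q.2.2)
      (Set.Ioi (0:ℝ) ×ˢ (Set.univ : Set (EuclideanSpace ℝ (Fin d) × EuclideanSpace ℝ (Fin d))))
  eqn : ∀ t : ℝ, 0 < t → ∀ x y : EuclideanSpace ℝ (Fin d), x ≠ y →
      ∃ L : ℝ, Filter.Tendsto (fun ε => Leps d κ J ε (fun x' => p t x' y) x)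
          (nhdsWithin 0 (Set.Ioi 0)) (nhds L)
        ∧ HasDerivAt (fun s => p s x y) L t
  upper : ∀ T : ℝ, 1 ≤ T → ∃ c : ℝ, 0 < c ∧ ∀ t : ℝ, 0 < t → t ≤ T →
      ∀ x y, p t x y ≤ c * t * Gfun d φ b β Φinv t (x - y)
  frac : ∀ T : ℝ, 1 ≤ T → ∃ c' : ℝ, 0 < c' ∧ ∀ ε : ℝ, 0 < ε → ε ≤ 1 →
      ∀ t : ℝ, 0 < t → t ≤ T → ∀ x y, x ≠ y →
      |Leps d κ J ε (fun x' => p t x' y) x| ≤ c' * Gtil d φ Φinv t (x - y)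
  approx : ∀ f : EuclideanSpace ℝ (Fin d) → ℝ, (∃ M, ∀ x, |f x| ≤ M) →
      UniformContinuous f → ∀ η : ℝ, 0 < η → ∃ t₀ : ℝ, 0 < t₀ ∧
      ∀ t : ℝ, 0 < t → t < t₀ → ∀ x, |(∫ y, p t x y * f y) - f x| ≤ η


/-- An integrable radial majorant with the decay rate of `Gtil` at infinity. -/
noncomputable def tailMajorant (d : ℕ) (w : EuclideanSpace ℝ (Fin d)) : ℝ :=
  ((1 + ‖w‖) ^ (d + 2))⁻¹

section TailMajorant

variable {d : ℕ}

lemma tailMajorant_pos (w : EuclideanSpace ℝ (Fin d)) : 0 < tailMajorant d w := by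
  unfold tailMajorant; positivity

lemma tailMajorant_le_one (w : EuclideanSpace ℝ (Fin d)) : tailMajorant d w ≤ 1 :=
  inv_le_one_of_one_le₀ (one_le_pow₀ (by linarith [norm_nonneg w]))

lemma integrable_tailMajorant : Integrable (tailMajorant d) := by
  have h := integrable_one_add_norm (E := EuclideanSpace ℝ (Fin d)) (μ := volume)
    (r := ((d + 2 : ℕ) : ℝ)) (by simp)
  refine h.congr (Eventually.of_forall fun w => ?_)
  have : (0 : ℝ) ≤ 1 + ‖w‖ := by positivity
  simp only [tailMajorant]
  rw [Real.rpow_neg this, Real.rpow_natCast]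

lemma integrable_tailMajorant_sub (x : EuclideanSpace ℝ (Fin d)) :
    Integrable fun y => tailMajorant d (x - y) :=
  integrable_tailMajorant.comp_sub_left x

lemma integral_tailMajorant_sub (x : EuclideanSpace ℝ (Fin d)) :
    ∫ y, tailMajorant d (x - y) = ∫ y, tailMajorant d y :=
  integral_sub_left_eq_self _ _ _

/-- Points at bounded norm are controlled by the majorant. -/
lemma one_le_mul_tailMajorant {w : EuclideanSpace ℝ (Fin d)} {R : ℝ} (h : ‖w‖ ≤ R) :
    1 ≤ (1 + R) ^ (d + 2) * tailMajorant d w := by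
  unfold tailMajorant
  rw [← div_eq_mul_inv, one_le_div (by positivity)]
  gcongr

/-- The majorant is comparable at points that are at distance at most one. -/
lemma tailMajorant_le_of_norm_sub_le {v w : EuclideanSpace ℝ (Fin d)} (h : ‖w - v‖ ≤ 1) :
    tailMajorant d v ≤ 2 ^ (d + 2) * tailMajorant d w := by
  unfold tailMajorant
  rw [← div_eq_mul_inv, inv_eq_one_div, div_le_div_iff₀ (by positivity) (by positivity), one_mul,
    ← mul_pow]
  have h1 : ‖w‖ ≤ ‖w - v‖ + ‖v‖ := by simpa using norm_add_le (w - v) v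
  gcongr
  linarith [norm_nonneg v]

end TailMajorant

section Bounds

variable {d : ℕ} {φ J : ℝ → ℝ} {a₁ α₁ C₀ a b β : ℝ}
  {κ : EuclideanSpace ℝ (Fin d) → EuclideanSpace ℝ (Fin d) → ℝ} {κ₀ κ₁ κ₂ δ : ℝ}
  {Φinv : ℝ → ℝ} {p : ℝ → EuclideanSpace ℝ (Fin d) → EuclideanSpace ℝ (Fin d) → ℝ}

lemma HKAssumptions.φ_pos (H : HKAssumptions d φ J a₁ α₁ C₀ a b β κ κ₀ κ₁ κ₂ δ)
    {s : ℝ} (hs : 0 < s) (hs1 : s ≤ 1) : 0 < φ s := by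
  have := H.φ_mono (show (0 : ℝ) ∈ Icc 0 1 by simp) ⟨hs.le, hs1⟩ hs
  rwa [H.φ_zero] at this

lemma HKAssumptions.C₀_nonneg (H : HKAssumptions d φ J a₁ α₁ C₀ a b β κ κ₀ κ₁ κ₂ δ) :
    0 ≤ C₀ := by
  rw [H.hC₀]
  exact setIntegral_nonneg measurableSet_Ioo fun s hs =>
    div_nonneg hs.1.le (H.φ_pos hs.1 hs.2.le).le

/-- Monotonicity of `φ` gives `Φ ≤ φ`. -/
lemma HKAssumptions.Phi_le (H : HKAssumptions d φ J a₁ α₁ C₀ a b β κ κ₀ κ₁ κ₂ δ)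
    {r : ℝ} (hr : 0 < r) (hr1 : r ≤ 1) : Phi φ r ≤ φ r := by
  have hφ := H.φ_pos hr hr1
  have hint : IntegrableOn (fun s => s / φ s) (Ioo 0 r) :=
    H.hI.mono_set (Ioo_subset_Ioo_right hr1)
  have hid : IntegrableOn (fun s : ℝ => s / φ r) (Ioo 0 r) :=
    ((continuous_id.div_const (φ r)).integrableOn_Icc (a := 0) (b := r)).mono_set
      Ioo_subset_Icc_self
  have hval : ∫ s in Ioo 0 r, s / φ r = r ^ 2 / (2 * φ r) := by
    rw [← integral_Ioc_eq_integral_Ioo, ← intervalIntegral.integral_of_le hr.le,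
      intervalIntegral.integral_div, integral_id]
    field_simp
    ring
  have hle : r ^ 2 / (2 * φ r) ≤ ∫ s in Ioo 0 r, s / φ s := by
    rw [← hval]
    refine setIntegral_mono_on hid hint measurableSet_Ioo fun s hs => ?_
    have hs1 : s ≤ 1 := hs.2.le.trans hr1
    exact div_le_div_of_nonneg_left hs.1.le (H.φ_pos hs.1 hs1)
      (H.φ_mono.monotoneOn ⟨hs.1.le, hs1⟩ ⟨hr.le, hr1⟩ hs.2.le)
  have hpos : 0 < r ^ 2 / (2 * φ r) := by positivity
  rw [Phi, if_pos hr1, div_le_iff₀ (by linarith)]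
  rw [div_le_iff₀ (by positivity)] at hle
  linarith

lemma HKAssumptions.Phi_inv_lower (H : HKAssumptions d φ J a₁ α₁ C₀ a b β κ κ₀ κ₁ κ₂ δ)
    (HΦ : PhiInvSpec φ Φinv) {s : ℝ} (hs : 0 < s) :
    ∃ r₀ > 0, ∀ t, s ≤ t → r₀ ≤ Φinv t := by
  have hc : ContinuousWithinAt φ (Icc 0 1) 0 := H.φ_cont 0 (by simp)
  have hev : ∀ᶠ r in nhdsWithin 0 (Icc (0 : ℝ) 1), φ r < s := by
    refine hc.eventually_lt_const ?_
    rwa [H.φ_zero]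
  obtain ⟨ρ, hρ, hsub⟩ := Metric.mem_nhdsWithin_iff.1 hev
  refine ⟨min ρ 1, by positivity, fun t hst => ?_⟩
  by_contra! hlt
  have hpos := HΦ.pos t (hs.trans_le hst)
  have h1 : Φinv t ≤ 1 := (hlt.trans_le (min_le_right _ _)).le
  have h2 : φ (Φinv t) < s := hsub ⟨by
    rw [Metric.mem_ball, Real.dist_eq, sub_zero, abs_of_pos hpos]
    exact hlt.trans_le (min_le_left _ _), hpos.le, h1⟩
  have h3 := H.Phi_le hpos h1
  rw [HΦ.right_inv t (hs.trans_le hst)] at h3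
  linarith

lemma HKAssumptions.Gtil_le_of_one_lt_norm
    (H : HKAssumptions d φ J a₁ α₁ C₀ a b β κ κ₀ κ₁ κ₂ δ) (t : ℝ)
    {w : EuclideanSpace ℝ (Fin d)} (hw : 1 < ‖w‖) :
    Gtil d φ Φinv t w ≤ 2 * C₀ * 2 ^ (d + 2) * tailMajorant d w := by
  have hw0 : w ≠ 0 := by rintro rfl; simp at hw; linarith
  have hC := H.C₀_nonneg
  rw [Gtil, if_neg hw0]
  refine (min_le_right _ _).trans ?_
  rw [Phi, if_neg (not_le.2 hw), ← H.hC₀]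
  have h1 : 1 / (‖w‖ ^ d * (1 / (2 * C₀) * ‖w‖ ^ 2)) = 2 * C₀ * (1 / ‖w‖ ^ (d + 2)) := by
    rw [pow_add]
    simp only [one_div, mul_inv, inv_inv]
    ring
  rw [h1, mul_assoc (2 * C₀)]
  gcongr
  unfold tailMajorant
  rw [← div_eq_mul_inv, div_le_div_iff₀ (by positivity) (by positivity), one_mul, ← mul_pow]
  gcongr
  linarith

lemma HKAssumptions.Gtil_le (H : HKAssumptions d φ J a₁ α₁ C₀ a b β κ κ₀ κ₁ κ₂ δ)
    (HΦ : PhiInvSpec φ Φinv) {s : ℝ} (hs : 0 < s) :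
    ∃ C, 0 ≤ C ∧ ∀ t, s ≤ t → ∀ w, Gtil d φ Φinv t w ≤ C * tailMajorant d w := by
  obtain ⟨r₀, hr₀, hr⟩ := H.Phi_inv_lower HΦ hs
  have hC := H.C₀_nonneg
  refine ⟨1 / (s * r₀ ^ d) * (1 + 1) ^ (d + 2) + 2 * C₀ * 2 ^ (d + 2), by positivity,
    fun t hst w => ?_⟩
  have hpos := tailMajorant_pos w
  rw [add_mul]
  rcases lt_or_ge 1 ‖w‖ with hw | hw
  · have := H.Gtil_le_of_one_lt_norm (Φinv := Φinv) t hw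
    have h2 : 0 ≤ 1 / (s * r₀ ^ d) * (1 + 1) ^ (d + 2) * tailMajorant d w := by positivity
    linarith
  · have h1 : Gtil d φ Φinv t w ≤ 1 / (t * Φinv t ^ d) := by
      unfold Gtil
      split_ifs
      · exact le_rfl
      · exact min_le_left _ _
    have h2 : 1 / (t * Φinv t ^ d) ≤ 1 / (s * r₀ ^ d) := by
      have := hr t hst
      have := hs.trans_le hst
      gcongr
    have h3 := mul_le_mul_of_nonneg_left (one_le_mul_tailMajorant hw)
      (show 0 ≤ 1 / (s * r₀ ^ d) by positivity)
    have h4 : 0 ≤ 2 * C₀ * 2 ^ (d + 2) * tailMajorant d w := by positivity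
    linarith

lemma GoodHeatKernel.abs_Leps_le (hp : GoodHeatKernel d φ J b β Φinv κ p)
    (H : HKAssumptions d φ J a₁ α₁ C₀ a b β κ κ₀ κ₁ κ₂ δ)
    (HΦ : PhiInvSpec φ Φinv) {s : ℝ} (hs : 0 < s) (T : ℝ) :
    ∃ C, 0 ≤ C ∧ ∀ ε, 0 < ε → ε ≤ 1 → ∀ t, s ≤ t → t ≤ T → ∀ x y, x ≠ y →
      |Leps d κ J ε (fun x' => p t x' y) x| ≤ C * tailMajorant d (x - y) := by
  obtain ⟨c, hc, hfrac⟩ := hp.frac (max T 1) (le_max_right _ _)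
  obtain ⟨C, hC, hG⟩ := H.Gtil_le HΦ hs
  refine ⟨c * C, by positivity, fun ε hε hε1 t hst htT x y hxy => ?_⟩
  refine (hfrac ε hε hε1 t (hs.trans_le hst) (htT.trans (le_max_left _ _)) x y hxy).trans ?_
  rw [mul_assoc]
  gcongr
  exact hG t hst _

lemma GoodHeatKernel.abs_Leps_le_of_one_lt (hp : GoodHeatKernel d φ J b β Φinv κ p)
    (H : HKAssumptions d φ J a₁ α₁ C₀ a b β κ κ₀ κ₁ κ₂ δ) (T : ℝ) :
    ∃ C, 0 ≤ C ∧ ∀ ε, 0 < ε → ε ≤ 1 → ∀ t, 0 < t → t ≤ T → ∀ x y, 1 < ‖x - y‖ →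
      |Leps d κ J ε (fun x' => p t x' y) x| ≤ C * tailMajorant d (x - y) := by
  obtain ⟨c, hc, hfrac⟩ := hp.frac (max T 1) (le_max_right _ _)
  have hC := H.C₀_nonneg
  refine ⟨c * (2 * C₀ * 2 ^ (d + 2)), by positivity, fun ε hε hε1 t ht htT x y hxy => ?_⟩
  have hne : x ≠ y := by rintro rfl; simp at hxy; linarith
  refine (hfrac ε hε hε1 t ht (htT.trans (le_max_left _ _)) x y hne).trans ?_
  rw [mul_assoc]
  gcongr
  exact H.Gtil_le_of_one_lt_norm t hxy

lemma GoodHeatKernel.tendsto_Leps (hp : GoodHeatKernel d φ J b β Φinv κ p)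
    {t : ℝ} (ht : 0 < t) {x y : EuclideanSpace ℝ (Fin d)} (hxy : x ≠ y) :
    Tendsto (fun ε => Leps d κ J ε (fun x' => p t x' y) x) (nhdsWithin 0 (Ioi 0))
      (nhds (deriv (fun s => p s x y) t)) := by
  obtain ⟨L, hL, hd⟩ := hp.eqn t ht x y hxy
  rwa [hd.deriv]

lemma GoodHeatKernel.hasDerivAt (hp : GoodHeatKernel d φ J b β Φinv κ p)
    {t : ℝ} (ht : 0 < t) {x y : EuclideanSpace ℝ (Fin d)} (hxy : x ≠ y) :
    HasDerivAt (fun s => p s x y) (deriv (fun s => p s x y) t) t := by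
  obtain ⟨L, hL, hd⟩ := hp.eqn t ht x y hxy
  rwa [hd.deriv]

lemma GoodHeatKernel.abs_deriv_le_of_forall_Leps (hp : GoodHeatKernel d φ J b β Φinv κ p)
    {t : ℝ} (ht : 0 < t) {x y : EuclideanSpace ℝ (Fin d)} (hxy : x ≠ y) {B : ℝ}
    (hB : ∀ ε, 0 < ε → ε ≤ 1 → |Leps d κ J ε (fun x' => p t x' y) x| ≤ B) :
    |deriv (fun s => p s x y) t| ≤ B := by
  refine le_of_tendsto (hp.tendsto_Leps ht hxy).abs ?_
  filter_upwards [Ioc_mem_nhdsGT (zero_lt_one' ℝ)] with ε hε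
  exact hB ε hε.1 hε.2

lemma GoodHeatKernel.abs_sub_le (hp : GoodHeatKernel d φ J b β Φinv κ p)
    {s t : ℝ} (hs : 0 < s) (hst : s ≤ t) {x y : EuclideanSpace ℝ (Fin d)} (hxy : x ≠ y) {B : ℝ}
    (hB : ∀ ε, 0 < ε → ε ≤ 1 → ∀ r, s ≤ r → r ≤ t →
      |Leps d κ J ε (fun x' => p r x' y) x| ≤ B) :
    |p t x y - p s x y| ≤ B * (t - s) := by
  have := (convex_Icc s t).norm_image_sub_le_of_norm_hasDerivWithin_le
    (f := fun r => p r x y) (f' := deriv fun r => p r x y) (C := B)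
    (fun r hr => (hp.hasDerivAt (hs.trans_le hr.1) hxy).hasDerivWithinAt)
    (fun r hr => hp.abs_deriv_le_of_forall_Leps (hs.trans_le hr.1) hxy
      fun ε hε hε1 => hB ε hε hε1 r hr.1 hr.2)
    (left_mem_Icc.2 hst) (right_mem_Icc.2 hst)
  simpa [Real.norm_eq_abs, abs_of_nonneg (sub_nonneg.2 hst)] using this

lemma GoodHeatKernel.continuous_right (hp : GoodHeatKernel d φ J b β Φinv κ p)
    {t : ℝ} (ht : 0 < t) (x : EuclideanSpace ℝ (Fin d)) : Continuous (p t x) := by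
  have := hp.cont.comp_continuous (f := fun y : EuclideanSpace ℝ (Fin d) => (t, x, y))
    (by fun_prop) (by simp [ht])
  exact this

/-- Off the diagonal the kernel vanishes at least linearly as `t ↓ 0`. -/
lemma GoodHeatKernel.abs_le_mul_tailMajorant (hp : GoodHeatKernel d φ J b β Φinv κ p)
    (H : HKAssumptions d φ J a₁ α₁ C₀ a b β κ κ₀ κ₁ κ₂ δ) (T : ℝ) :
    ∃ C, 0 ≤ C ∧ ∀ t, 0 < t → t ≤ T → ∀ x y, 1 < ‖x - y‖ →
      |p t x y| ≤ C * t * tailMajorant d (x - y) := by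
  obtain ⟨C, hC, hL⟩ := hp.abs_Leps_le_of_one_lt H T
  refine ⟨C, hC, ?_⟩
  have hlip : ∀ s t, 0 < s → s ≤ t → t ≤ T → ∀ x y, 1 < ‖x - y‖ →
      |p t x y - p s x y| ≤ C * tailMajorant d (x - y) * (t - s) := by
    intro s t hs hst htT x y hxy
    have hne : x ≠ y := by rintro rfl; simp at hxy; linarith
    exact hp.abs_sub_le hs hst hne fun ε hε hε1 r hsr hrt =>
      hL ε hε hε1 r (hs.trans_le hsr) (hrt.trans htT) x y hxy
  have hlin : ∀ s, 0 < s → s ≤ T → ∀ x y, 1 < ‖x - y‖ → |p s x y| ≤ C * s := by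
    intro s hs hsT x y₀ hxy
    refine le_of_forall_pos_le_add fun η hη => ?_
    have hev : ∀ᶠ y in nhds y₀, 1 < ‖x - y‖ ∧ |p s x y - p s x y₀| < η / 2 := by
      refine Filter.Eventually.and ?_ ?_
      · exact (show Continuous fun y => ‖x - y‖ by fun_prop).continuousAt.eventually_const_lt hxy
      · have hc : Continuous fun y => |p s x y - p s x y₀| :=
          ((hp.continuous_right hs x).sub continuous_const).abs
        exact hc.continuousAt.eventually_lt_const (by simpa using hη)
    obtain ⟨ρ, hρ, hball⟩ := Metric.eventually_nhds_iff_ball.1 hev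
    let f : ContDiffBump y₀ := ⟨ρ / 2, ρ, by positivity, by linarith⟩
    let g := f.normed volume
    have hg0 : ∀ y, 0 ≤ g y := f.nonneg_normed
    have hgc : Continuous g := f.continuous_normed
    have hgs : HasCompactSupport g := f.hasCompactSupport_normed
    have hg1 : ∫ y, g y = 1 := f.integral_normed
    have hgz : ∀ y, y ∉ Metric.ball y₀ ρ → g y = 0 := fun y hy => by
      have : Function.support g = Metric.ball y₀ ρ := f.support_normed_eq
      rw [← this] at hy
      simpa using hy
    have hgi : Integrable g := f.integrable_normed
    have hgx : g x = 0 := hgz x fun hx => by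
      have := (hball x hx).1
      simp at this
      linarith
    obtain ⟨M, hM⟩ := hgc.bounded_above_of_compact_support hgs
    obtain ⟨t₀, ht₀, happ⟩ := hp.approx g ⟨M, hM⟩
      (hgs.uniformContinuous_of_continuous hgc) (η / 2) (by positivity)
    obtain ⟨t, ht, htlt⟩ := exists_between (lt_min ht₀ hs)
    have h1 := happ t ht (htlt.trans_le (min_le_left _ _)) x
    rw [hgx, sub_zero] at h1
    have hts : t ≤ s := (htlt.trans_le (min_le_right _ _)).le
    have hpgi : Integrable fun y => p t x y * g y :=
      ((hp.continuous_right ht x).mul hgc).integrable_of_hasCompactSupport hgs.mul_left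
    have h2 : |(∫ y, p t x y * g y) - p s x y₀| ≤ η / 2 + C * s := by
      have he : (∫ y, p t x y * g y) - p s x y₀ = ∫ y, (p t x y - p s x y₀) * g y := by
        simp_rw [sub_mul]
        rw [integral_sub hpgi (hgi.const_mul _), integral_const_mul, hg1, mul_one]
      have hb : ∫ y, (η / 2 + C * s) * g y = η / 2 + C * s := by
        rw [integral_const_mul, hg1, mul_one]
      rw [he, ← hb, ← Real.norm_eq_abs]
      refine norm_integral_le_of_norm_le (hgi.const_mul _) (Eventually.of_forall fun y => ?_)
      rw [norm_mul, Real.norm_of_nonneg (hg0 y)]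
      by_cases hy : y ∈ Metric.ball y₀ ρ
      · obtain ⟨hy1, hy2⟩ := hball y hy
        have h3 := hlip t s ht hts hsT x y hy1
        have h4 : C * tailMajorant d (x - y) * (s - t) ≤ C * 1 * s := by
          gcongr
          · exact tailMajorant_le_one _
          · linarith
        refine mul_le_mul_of_nonneg_right ?_ (hg0 y)
        rw [Real.norm_eq_abs]
        rw [abs_le] at h3 ⊢
        rw [abs_lt] at hy2
        constructor <;> linarith [h3.1, h3.2, hy2.1, hy2.2]
      · simp [hgz y hy]
    rw [abs_le] at h1 h2 ⊢
    constructor <;> linarith [h1.1, h1.2, h2.1, h2.2]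
  intro t ht htT x y hxy
  refine le_of_forall_pos_le_add fun η hη => ?_
  obtain ⟨s, hs, hslt⟩ := exists_between (lt_min ht (show 0 < η / (C + 1) by positivity))
  have hst : s ≤ t := (hslt.trans_le (min_le_left _ _)).le
  have h1 := hlin s hs (hst.trans htT) x y hxy
  have h2 := hlip s t hs hst htT x y hxy
  have h3 : (C + 1) * s ≤ η := by
    have := (hslt.trans_le (min_le_right _ _)).le
    rw [le_div_iff₀ (by positivity)] at this
    linarith
  have h4 : C * tailMajorant d (x - y) * (t - s) ≤ C * tailMajorant d (x - y) * t := by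
    have := tailMajorant_pos (x - y)
    gcongr
    linarith
  rw [abs_le] at h1 h2 ⊢
  constructor <;> linarith [h1.1, h1.2, h2.1, h2.2]

/-- A dominating function for the kernel that is uniform for nearby times and starting points. -/
lemma GoodHeatKernel.eventually_abs_le (hp : GoodHeatKernel d φ J b β Φinv κ p)
    (H : HKAssumptions d φ J a₁ α₁ C₀ a b β κ κ₀ κ₁ κ₂ δ) {t : ℝ} (ht : 0 < t)
    (x : EuclideanSpace ℝ (Fin d)) :
    ∃ C, 0 ≤ C ∧ ∀ᶠ q : ℝ × EuclideanSpace ℝ (Fin d) in nhds (t, x),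
      0 < q.1 ∧ ∀ y, |p q.1 q.2 y| ≤ C * tailMajorant d (x - y) := by
  obtain ⟨C, hC, hfar⟩ := hp.abs_le_mul_tailMajorant H (2 * t)
  obtain ⟨M, hM⟩ := ((isCompact_Icc (a := t / 2) (b := 2 * t)).prod
    ((isCompact_closedBall x 1).prod (isCompact_closedBall x 2))).exists_bound_of_continuousOn
    (hp.cont.mono (Set.prod_mono (fun s hs => (show 0 < t / 2 by positivity).trans_le hs.1)
      (subset_univ _)))
  have hM0 : 0 ≤ M := (norm_nonneg _).trans <| hM (t, x, x)
    ⟨⟨by linarith, by linarith⟩, by simp, by simp⟩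
  refine ⟨M * (1 + 2) ^ (d + 2) + C * (2 * t) * 2 ^ (d + 2), by positivity, ?_⟩
  have hnhds : Icc (t / 2) (2 * t) ×ˢ Metric.closedBall x 1 ∈ nhds (t, x) :=
    prod_mem_nhds (Icc_mem_nhds (by linarith) (by linarith))
      (Metric.closedBall_mem_nhds x one_pos)
  filter_upwards [hnhds] with ⟨s, x'⟩ ⟨hs, hx'⟩
  have hs0 : 0 < s := (show 0 < t / 2 by positivity).trans_le hs.1
  refine ⟨hs0, fun y => ?_⟩
  have hpos := tailMajorant_pos (x - y)
  rw [add_mul]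
  rcases le_or_gt ‖x - y‖ 2 with hy | hy
  · have h1 := hM (s, x', y) ⟨hs, hx', by rwa [Metric.mem_closedBall, dist_comm, dist_eq_norm]⟩
    have h2 := mul_le_mul_of_nonneg_left (one_le_mul_tailMajorant hy) hM0
    have h3 : 0 ≤ C * (2 * t) * 2 ^ (d + 2) * tailMajorant d (x - y) := by positivity
    rw [Real.norm_eq_abs] at h1
    dsimp only at h1 ⊢
    linarith
  · rw [mem_closedBall_iff_norm] at hx'
    have hxx : ‖x - y - (x' - y)‖ ≤ 1 := by
      rwa [sub_sub_sub_cancel_right, norm_sub_rev]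
    have hxy : 1 < ‖x' - y‖ := by
      have := norm_add_le (x - y - (x' - y)) (x' - y)
      rw [sub_add_cancel] at this
      linarith
    have h1 := hfar s hs0 hs.2 x' y hxy
    have h2 := tailMajorant_le_of_norm_sub_le hxx
    have h3 : C * s * tailMajorant d (x' - y)
        ≤ C * (2 * t) * (2 ^ (d + 2) * tailMajorant d (x - y)) := by
      have := hs.2
      have := (tailMajorant_pos (x' - y)).le
      gcongr
    have h4 : 0 ≤ M * (1 + 2) ^ (d + 2) * tailMajorant d (x - y) := by positivity
    dsimp only
    linarith

lemma GoodHeatKernel.integrable (hp : GoodHeatKernel d φ J b β Φinv κ p)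
    (H : HKAssumptions d φ J a₁ α₁ C₀ a b β κ κ₀ κ₁ κ₂ δ) {t : ℝ} (ht : 0 < t)
    (x : EuclideanSpace ℝ (Fin d)) : Integrable (p t x) := by
  obtain ⟨C, -, hC⟩ := hp.eventually_abs_le H ht x
  exact ((integrable_tailMajorant_sub x).const_mul C).mono'
    (hp.continuous_right ht x).aestronglyMeasurable
    (Eventually.of_forall hC.self_of_nhds.2)

lemma GoodHeatKernel.continuousAt_integral (hp : GoodHeatKernel d φ J b β Φinv κ p)
    (H : HKAssumptions d φ J a₁ α₁ C₀ a b β κ κ₀ κ₁ κ₂ δ) {t : ℝ} (ht : 0 < t)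
    (x : EuclideanSpace ℝ (Fin d)) :
    ContinuousAt (fun q : ℝ × EuclideanSpace ℝ (Fin d) => ∫ y, p q.1 q.2 y) (t, x) := by
  obtain ⟨C, -, hC⟩ := hp.eventually_abs_le H ht x
  refine continuousAt_of_dominated (bound := fun y => C * tailMajorant d (x - y)) ?_ ?_
    ((integrable_tailMajorant_sub x).const_mul C) (Eventually.of_forall fun y => ?_)
  · filter_upwards [hC] with q hq
    exact (hp.continuous_right hq.1 q.2).aestronglyMeasurable
  · filter_upwards [hC] with q hq
    exact Eventually.of_forall hq.2
  · have hmem : Ioi (0 : ℝ) ×ˢ (univ : Set (EuclideanSpace ℝ (Fin d) × EuclideanSpace ℝ (Fin d)))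
        ∈ nhds (t, x, y) := prod_mem_nhds (Ioi_mem_nhds ht) univ_mem
    exact (hp.cont.continuousAt hmem).comp
      (f := fun q : ℝ × EuclideanSpace ℝ (Fin d) => (q.1, q.2, y)) (x := (t, x)) (by fun_prop)

lemma HKAssumptions.nontrivial (H : HKAssumptions d φ J a₁ α₁ C₀ a b β κ κ₀ κ₁ κ₂ δ) :
    Nontrivial (EuclideanSpace ℝ (Fin d)) := by
  have : Nonempty (Fin d) := ⟨⟨0, H.hd⟩⟩
  infer_instance

lemma HKAssumptions.ae_ne (H : HKAssumptions d φ J a₁ α₁ C₀ a b β κ κ₀ κ₁ κ₂ δ)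
    (x : EuclideanSpace ℝ (Fin d)) : ∀ᵐ y, x ≠ y := by
  have := H.nontrivial
  filter_upwards [Measure.ae_ne volume x] with y hy using hy.symm

lemma GoodHeatKernel.abs_integral_le (hp : GoodHeatKernel d φ J b β Φinv κ p)
    (H : HKAssumptions d φ J a₁ α₁ C₀ a b β κ κ₀ κ₁ κ₂ δ) (HΦ : PhiInvSpec φ Φinv) (T : ℝ) :
    ∃ B, ∀ t, 0 < t → t ≤ T → ∀ x, |∫ y, p t x y| ≤ B := by
  obtain ⟨t₀, ht₀, happ⟩ := hp.approx (fun _ => 1) ⟨1, by simp⟩ uniformContinuous_const 1 one_pos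
  simp only [mul_one] at happ
  have hs : 0 < t₀ / 2 := by positivity
  obtain ⟨C, hC, hL⟩ := hp.abs_Leps_le H HΦ hs T
  have hI : 0 ≤ ∫ y : EuclideanSpace ℝ (Fin d), tailMajorant d y :=
    integral_nonneg fun y => (tailMajorant_pos y).le
  refine ⟨2 + C * |T| * ∫ y : EuclideanSpace ℝ (Fin d), tailMajorant d y, fun t ht htT x => ?_⟩
  have hE : 0 ≤ C * |T| * ∫ y : EuclideanSpace ℝ (Fin d), tailMajorant d y := by positivity
  rcases lt_or_ge t t₀ with h | h
  · have := happ t ht h x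
    rw [abs_le] at this ⊢
    constructor <;> linarith
  · have h1 := happ (t₀ / 2) hs (by linarith) x
    have h2 : |∫ y, (p t x y - p (t₀ / 2) x y)|
        ≤ ∫ y, C * |T| * tailMajorant d (x - y) := by
      rw [← Real.norm_eq_abs]
      refine norm_integral_le_of_norm_le ((integrable_tailMajorant_sub x).const_mul _) ?_
      filter_upwards [H.ae_ne x] with y hy
      refine (hp.abs_sub_le hs (by linarith) hy fun ε hε hε1 r hr hrt =>
        hL ε hε hε1 r hr (hrt.trans htT) x y hy).trans ?_
      have := le_abs_self T
      have := tailMajorant_pos (x - y)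
      calc C * tailMajorant d (x - y) * (t - t₀ / 2)
          ≤ C * tailMajorant d (x - y) * |T| := by gcongr; linarith
        _ = _ := by ring
    rw [integral_sub (hp.integrable H ht x) (hp.integrable H hs x), integral_const_mul,
      integral_tailMajorant_sub] at h2
    rw [abs_le] at h1 h2 ⊢
    constructor <;> linarith [h1.1, h1.2, h2.1, h2.2]

lemma GoodHeatKernel.le_mul_tailMajorant (hp : GoodHeatKernel d φ J b β Φinv κ p)
    (H : HKAssumptions d φ J a₁ α₁ C₀ a b β κ κ₀ κ₁ κ₂ δ) (HΦ : PhiInvSpec φ Φinv)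
    {t : ℝ} (ht : 0 < t) :
    ∃ C, 0 ≤ C ∧ ∀ x y, p t x y ≤ C * tailMajorant d (x - y) := by
  obtain ⟨c, hc, hup⟩ := hp.upper (max t 1) (le_max_right _ _)
  obtain ⟨C, hC, hfar⟩ := hp.abs_le_mul_tailMajorant H t
  have hΦ := HΦ.pos t ht
  have hM : 0 ≤ c * t * (1 / (t * Φinv t ^ d)) := by positivity
  refine ⟨c * t * (1 / (t * Φinv t ^ d)) * (1 + 1) ^ (d + 2) + C * t, by positivity,
    fun x y => ?_⟩
  have hpos := tailMajorant_pos (x - y)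
  rw [add_mul]
  rcases le_or_gt ‖x - y‖ 1 with hy | hy
  · have h1 : Gfun d φ b β Φinv t (x - y) ≤ 1 / (t * Φinv t ^ d) := by
      unfold Gfun
      split_ifs
      · exact le_rfl
      · exact min_le_left _ _
    have h2 := hup t ht (le_max_left _ _) x y
    have h3 := mul_le_mul_of_nonneg_left h1 (show 0 ≤ c * t by positivity)
    have h4 := mul_le_mul_of_nonneg_left (one_le_mul_tailMajorant hy) hM
    have h5 : 0 ≤ C * t * tailMajorant d (x - y) := by positivity
    linarith
  · have h1 := (le_abs_self _).trans (hfar t ht le_rfl x y hy)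
    have h2 : 0 ≤ c * t * (1 / (t * Φinv t ^ d)) * (1 + 1) ^ (d + 2) * tailMajorant d (x - y) := by
      positivity
    linarith

lemma GoodHeatKernel.integral_abs_le (hp : GoodHeatKernel d φ J b β Φinv κ p)
    (H : HKAssumptions d φ J a₁ α₁ C₀ a b β κ κ₀ κ₁ κ₂ δ) (HΦ : PhiInvSpec φ Φinv)
    {t : ℝ} (ht : 0 < t) : ∃ N, ∀ x, ∫ y, |p t x y| ≤ N := by
  obtain ⟨C, hC, hup⟩ := hp.le_mul_tailMajorant H HΦ ht
  obtain ⟨B, hB⟩ := hp.abs_integral_le H HΦ t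
  refine ⟨2 * C * (∫ y : EuclideanSpace ℝ (Fin d), tailMajorant d y) + B, fun x => ?_⟩
  have hi := hp.integrable H ht x
  have hm := (integrable_tailMajorant_sub x).const_mul (2 * C)
  calc ∫ y, |p t x y| ≤ ∫ y, (2 * C * tailMajorant d (x - y) - p t x y) := by
        refine integral_mono hi.abs (hm.sub hi) fun y => ?_
        have := hup x y
        have := tailMajorant_pos (x - y)
        have : 0 ≤ C * tailMajorant d (x - y) := by positivity
        rw [abs_le]
        constructor <;> linarith
    _ = 2 * C * (∫ y : EuclideanSpace ℝ (Fin d), tailMajorant d y) - ∫ y, p t x y := by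
        rw [integral_sub hm hi, integral_const_mul, integral_tailMajorant_sub]
    _ ≤ _ := by linarith [(abs_le.1 (hB t ht le_rfl x)).1]

/-- The jump kernel has a finite second moment. -/
lemma HKAssumptions.integrable_sq_mul_J (H : HKAssumptions d φ J a₁ α₁ C₀ a b β κ κ₀ κ₁ κ₂ δ) :
    Integrable fun z : EuclideanSpace ℝ (Fin d) => ‖z‖ ^ 2 * J ‖z‖ := by
  have := H.nontrivial
  have hd := H.hd
  have ha : 0 ≤ a := zero_le_one.trans H.ha
  refine (integrable_fun_norm_addHaar (volume : Measure (EuclideanSpace ℝ (Fin d)))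
    (f := fun r : ℝ => r ^ 2 * J r)).2 ?_
  simp only [finrank_euclideanSpace, Fintype.card_fin, smul_eq_mul]
  have heq : ∀ y : ℝ, y ^ (d - 1) * (y ^ 2 * J y) = y ^ (d + 1) * J y := fun y => by
    rw [← mul_assoc, ← pow_add]
    congr 2
    omega
  simp_rw [heq]
  have hcont : ContinuousOn (fun y : ℝ => y ^ (d + 1) * J y) (Ioi 0) :=
    (continuous_pow _).continuousOn.mul H.J_cont
  rw [← Ioc_union_Ioi_eq_Ioi (zero_le_one' ℝ)]
  refine IntegrableOn.union ?_ ?_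
  · have h1 : IntegrableOn (fun s => a * (s / φ s)) (Ioc 0 1) :=
      ((integrableOn_Ioc_iff_integrableOn_Ioo).2 H.hI).const_mul a
    refine h1.mono' ((hcont.mono Ioc_subset_Ioi_self).aestronglyMeasurable measurableSet_Ioc) ?_
    filter_upwards [ae_restrict_mem measurableSet_Ioc] with y hy
    have hJ := H.J_pos y hy.1
    have hφ := H.φ_pos hy.1 hy.2
    have hy0 := hy.1
    rw [Real.norm_of_nonneg (by positivity)]
    calc y ^ (d + 1) * J y ≤ y ^ (d + 1) * (a / (y ^ d * φ y)) := by
          gcongr; exact H.hJ1_up y hy.1 hy.2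
      _ = a * (y / φ y) := by
          rw [pow_succ]
          field_simp
  · have h1 : IntegrableOn (fun y : ℝ => a * (y ^ ((d + 1 : ℕ) : ℝ) * Real.exp (-b * y ^ β)))
        (Ioi 1) :=
      ((integrableOn_rpow_mul_exp_neg_mul_rpow
        ((by norm_num : (-1 : ℝ) < 0).trans_le (Nat.cast_nonneg _)) H.β_pos H.hb).mono_set
        (Ioi_subset_Ioi zero_le_one)).const_mul a
    refine h1.mono' ((hcont.mono (Ioi_subset_Ioi zero_le_one)).aestronglyMeasurable
      measurableSet_Ioi) ?_
    filter_upwards [ae_restrict_mem measurableSet_Ioi] with y hy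
    have hy0 : 0 < y := zero_lt_one.trans hy
    have hJ := H.J_pos y hy0
    rw [Real.norm_of_nonneg (by positivity), Real.rpow_natCast]
    calc y ^ (d + 1) * J y ≤ y ^ (d + 1) * (a * Real.exp (-b * y ^ β)) := by
          gcongr; exact H.hJ1_exp y hy
      _ = _ := by ring

lemma measurableSet_lt_norm (ε : ℝ) :
    MeasurableSet {z : EuclideanSpace ℝ (Fin d) | ε < ‖z‖} :=
  measurableSet_lt measurable_const measurable_norm

lemma HKAssumptions.aestronglyMeasurable_J
    (H : HKAssumptions d φ J a₁ α₁ C₀ a b β κ κ₀ κ₁ κ₂ δ) {ε : ℝ} (hε : 0 < ε) :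
    AEStronglyMeasurable (fun z : EuclideanSpace ℝ (Fin d) => J ‖z‖)
      (volume.restrict {z | ε < ‖z‖}) := by
  refine ContinuousOn.aestronglyMeasurable ?_ (measurableSet_lt_norm ε)
  exact H.J_cont.comp continuous_norm.continuousOn fun z hz => hε.trans hz

lemma HKAssumptions.integrableOn_J (H : HKAssumptions d φ J a₁ α₁ C₀ a b β κ κ₀ κ₁ κ₂ δ)
    {ε : ℝ} (hε : 0 < ε) :
    IntegrableOn (fun z : EuclideanSpace ℝ (Fin d) => J ‖z‖) {z | ε < ‖z‖} := by
  refine (H.integrable_sq_mul_J.integrableOn.const_mul (ε ^ 2)⁻¹).mono'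
    (H.aestronglyMeasurable_J hε) ?_
  filter_upwards [ae_restrict_mem (measurableSet_lt_norm ε)] with z (hz : ε < ‖z‖)
  have hJ := H.J_pos ‖z‖ (hε.trans hz)
  rw [Real.norm_of_nonneg hJ.le, ← mul_assoc]
  refine le_mul_of_one_le_left hJ.le ?_
  rw [mul_comm, ← div_eq_mul_inv, one_le_div (by positivity)]
  gcongr

lemma HKAssumptions.aestronglyMeasurable_kernel
    (H : HKAssumptions d φ J a₁ α₁ C₀ a b β κ κ₀ κ₁ κ₂ δ) (x : EuclideanSpace ℝ (Fin d))
    {ε : ℝ} (hε : 0 < ε) :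
    AEStronglyMeasurable (fun z => κ x z * J ‖z‖) (volume.restrict {z | ε < ‖z‖}) :=
  (H.κ_meas.comp measurable_prodMk_left).aestronglyMeasurable.mul (H.aestronglyMeasurable_J hε)

lemma HKAssumptions.kernel_nonneg (H : HKAssumptions d φ J a₁ α₁ C₀ a b β κ κ₀ κ₁ κ₂ δ)
    (x : EuclideanSpace ℝ (Fin d)) {z : EuclideanSpace ℝ (Fin d)} (hz : 0 < ‖z‖) :
    0 ≤ κ x z * J ‖z‖ :=
  mul_nonneg (H.κ₀_pos.le.trans (H.κ_low x z)) (H.J_pos _ hz).le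

lemma HKAssumptions.kernel_le (H : HKAssumptions d φ J a₁ α₁ C₀ a b β κ κ₀ κ₁ κ₂ δ)
    (x : EuclideanSpace ℝ (Fin d)) {z : EuclideanSpace ℝ (Fin d)} (hz : 0 < ‖z‖) :
    κ x z * J ‖z‖ ≤ κ₁ * J ‖z‖ :=
  mul_le_mul_of_nonneg_right (H.κ_up x z) (H.J_pos _ hz).le

lemma GoodHeatKernel.integrable_uncurry (hp : GoodHeatKernel d φ J b β Φinv κ p)
    (H : HKAssumptions d φ J a₁ α₁ C₀ a b β κ κ₀ κ₁ κ₂ δ) (HΦ : PhiInvSpec φ Φinv)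
    {t : ℝ} (ht : 0 < t) (x : EuclideanSpace ℝ (Fin d)) {ε : ℝ} (hε : 0 < ε) :
    Integrable (Function.uncurry fun z y => (p t (x + z) y - p t x y) * (κ x z * J ‖z‖))
      ((volume.restrict {z | ε < ‖z‖}).prod volume) := by
  obtain ⟨N, hN⟩ := hp.integral_abs_le H HΦ ht
  have hcont : Continuous fun q : EuclideanSpace ℝ (Fin d) × EuclideanSpace ℝ (Fin d) =>
      p t (x + q.1) q.2 - p t x q.2 := by
    refine Continuous.sub ?_ ((hp.continuous_right ht x).comp continuous_snd)
    exact hp.cont.comp_continuous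
      (f := fun q : EuclideanSpace ℝ (Fin d) × EuclideanSpace ℝ (Fin d) => (t, x + q.1, q.2))
      (by fun_prop) (by simp [ht])
  have hmeas : AEStronglyMeasurable
      (Function.uncurry fun z y => (p t (x + z) y - p t x y) * (κ x z * J ‖z‖))
      ((volume.restrict {z | ε < ‖z‖}).prod volume) :=
    hcont.aestronglyMeasurable.mul (H.aestronglyMeasurable_kernel x hε).comp_fst
  rw [integrable_prod_iff hmeas]
  refine ⟨Eventually.of_forall fun z =>
    ((hp.integrable H ht (x + z)).sub (hp.integrable H ht x)).mul_const (κ x z * J ‖z‖), ?_⟩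
  refine ((H.integrableOn_J hε).const_mul (2 * N * κ₁)).mono'
    hmeas.norm.integral_prod_right' ?_
  filter_upwards [ae_restrict_mem (measurableSet_lt_norm ε)] with z (hz : ε < ‖z‖)
  have hk := H.kernel_nonneg x (hε.trans hz)
  have hk1 := H.kernel_le x (hε.trans hz)
  rw [Real.norm_of_nonneg (integral_nonneg fun y => norm_nonneg _)]
  simp only [Function.uncurry_apply_pair, norm_mul, integral_mul_const]
  have hN0 : 0 ≤ N := (integral_nonneg fun y => abs_nonneg _).trans (hN x)
  have h1 : ∫ y, ‖p t (x + z) y - p t x y‖ ≤ 2 * N := by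
    have hi1 := (hp.integrable H ht (x + z)).abs
    have hi2 := (hp.integrable H ht x).abs
    calc ∫ y, ‖p t (x + z) y - p t x y‖ ≤ ∫ y, (|p t (x + z) y| + |p t x y|) :=
          integral_mono ((hp.integrable H ht _).sub (hp.integrable H ht _)).norm (hi1.add hi2)
            fun y => norm_sub_le _ _
      _ ≤ 2 * N := by
          rw [integral_add hi1 hi2]
          linarith [hN (x + z), hN x]
  rw [← norm_mul, Real.norm_of_nonneg hk, mul_assoc]
  gcongr

lemma GoodHeatKernel.integral_inner_eq (hp : GoodHeatKernel d φ J b β Φinv κ p)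
    (H : HKAssumptions d φ J a₁ α₁ C₀ a b β κ κ₀ κ₁ κ₂ δ)
    {t : ℝ} (ht : 0 < t) (x z : EuclideanSpace ℝ (Fin d)) :
    ∫ y, (p t (x + z) y - p t x y) * (κ x z * J ‖z‖)
      = ((∫ y, p t (x + z) y) - ∫ y, p t x y) * (κ x z * J ‖z‖) := by
  rw [integral_mul_const, integral_sub (hp.integrable H ht _) (hp.integrable H ht _)]

lemma GoodHeatKernel.integrableOn_integral_sub (hp : GoodHeatKernel d φ J b β Φinv κ p)
    (H : HKAssumptions d φ J a₁ α₁ C₀ a b β κ κ₀ κ₁ κ₂ δ) (HΦ : PhiInvSpec φ Φinv)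
    {t : ℝ} (ht : 0 < t) (x : EuclideanSpace ℝ (Fin d)) {ε : ℝ} (hε : 0 < ε) :
    IntegrableOn (fun z => ((∫ y, p t (x + z) y) - ∫ y, p t x y) * (κ x z * J ‖z‖))
      {z | ε < ‖z‖} := by
  simp_rw [← hp.integral_inner_eq H ht x]
  exact (hp.integrable_uncurry H HΦ ht x hε).integral_prod_left

lemma GoodHeatKernel.integrable_Leps (hp : GoodHeatKernel d φ J b β Φinv κ p)
    (H : HKAssumptions d φ J a₁ α₁ C₀ a b β κ κ₀ κ₁ κ₂ δ) (HΦ : PhiInvSpec φ Φinv)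
    {t : ℝ} (ht : 0 < t) (x : EuclideanSpace ℝ (Fin d)) {ε : ℝ} (hε : 0 < ε) :
    Integrable fun y => Leps d κ J ε (fun x' => p t x' y) x :=
  (hp.integrable_uncurry H HΦ ht x hε).integral_prod_right

lemma GoodHeatKernel.Leps_integral (hp : GoodHeatKernel d φ J b β Φinv κ p)
    (H : HKAssumptions d φ J a₁ α₁ C₀ a b β κ κ₀ κ₁ κ₂ δ) (HΦ : PhiInvSpec φ Φinv)
    {t : ℝ} (ht : 0 < t) (x : EuclideanSpace ℝ (Fin d)) {ε : ℝ} (hε : 0 < ε) :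
    Leps d κ J ε (fun x' => ∫ y, p t x' y) x
      = ∫ y, Leps d κ J ε (fun x' => p t x' y) x := by
  unfold Leps
  simp_rw [← hp.integral_inner_eq H ht x]
  exact integral_integral_swap (hp.integrable_uncurry H HΦ ht x hε)

/-- The total mass solves the heat equation of `L^κ`. -/
lemma GoodHeatKernel.tendsto_Leps_integral (hp : GoodHeatKernel d φ J b β Φinv κ p)
    (H : HKAssumptions d φ J a₁ α₁ C₀ a b β κ κ₀ κ₁ κ₂ δ) (HΦ : PhiInvSpec φ Φinv)
    {t : ℝ} (ht : 0 < t) (x : EuclideanSpace ℝ (Fin d)) :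
    Tendsto (fun ε => Leps d κ J ε (fun x' => ∫ y, p t x' y) x) (nhdsWithin 0 (Ioi 0))
      (nhds (∫ y, deriv (fun s => p s x y) t)) := by
  obtain ⟨C, hC, hL⟩ := hp.abs_Leps_le H HΦ ht t
  have hlim := tendsto_integral_filter_of_dominated_convergence
    (F := fun ε y => Leps d κ J ε (fun x' => p t x' y) x)
    (f := fun y => deriv (fun s => p s x y) t) (μ := volume) (l := nhdsWithin 0 (Ioi 0))
    (fun y => C * tailMajorant d (x - y)) ?_ ?_ ((integrable_tailMajorant_sub x).const_mul C) ?_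
  · refine hlim.congr' ?_
    filter_upwards [self_mem_nhdsWithin] with ε hε
    exact (hp.Leps_integral H HΦ ht x hε).symm
  · filter_upwards [self_mem_nhdsWithin] with ε hε
    exact (hp.integrable_Leps H HΦ ht x hε).aestronglyMeasurable
  · filter_upwards [Ioc_mem_nhdsGT (zero_lt_one' ℝ)] with ε hε
    filter_upwards [H.ae_ne x] with y hy
    exact hL ε hε.1 hε.2 t le_rfl le_rfl x y hy
  · filter_upwards [H.ae_ne x] with y hy
    exact hp.tendsto_Leps ht hy

lemma GoodHeatKernel.hasDerivAt_integral (hp : GoodHeatKernel d φ J b β Φinv κ p)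
    (H : HKAssumptions d φ J a₁ α₁ C₀ a b β κ κ₀ κ₁ κ₂ δ) (HΦ : PhiInvSpec φ Φinv)
    {t : ℝ} (ht : 0 < t) (x : EuclideanSpace ℝ (Fin d)) :
    HasDerivAt (fun s => ∫ y, p s x y) (∫ y, deriv (fun s => p s x y) t) t := by
  have ht2 : 0 < t / 2 := by positivity
  obtain ⟨C, hC, hL⟩ := hp.abs_Leps_le H HΦ ht2 (2 * t)
  refine (hasDerivAt_integral_of_dominated_loc_of_deriv_le
    (F := fun s y => p s x y) (F' := fun s y => deriv (fun s => p s x y) s)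
    (bound := fun y => C * tailMajorant d (x - y))
    (Icc_mem_nhds (show t / 2 < t by linarith) (show t < 2 * t by linarith)) ?_
    (hp.integrable H ht x) ?_ ?_ ((integrable_tailMajorant_sub x).const_mul C) ?_).2
  · filter_upwards [Ioi_mem_nhds ht] with s hs
    exact (hp.continuous_right hs x).aestronglyMeasurable
  · have hseq : Tendsto (fun n : ℕ => 1 / ((n : ℝ) + 1)) atTop (nhdsWithin 0 (Ioi 0)) :=
      tendsto_nhdsWithin_iff.2 ⟨tendsto_one_div_add_atTop_nhds_zero_nat,
        Eventually.of_forall fun n => mem_Ioi.2 Nat.one_div_pos_of_nat⟩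
    refine aestronglyMeasurable_of_tendsto_ae atTop
      (f := fun (n : ℕ) y => Leps d κ J (1 / ((n : ℝ) + 1)) (fun x' => p t x' y) x)
      (fun n => (hp.integrable_Leps H HΦ ht x Nat.one_div_pos_of_nat).aestronglyMeasurable) ?_
    filter_upwards [H.ae_ne x] with y hy
    exact (hp.tendsto_Leps ht hy).comp hseq
  · filter_upwards [H.ae_ne x] with y hy s hs
    exact hp.abs_deriv_le_of_forall_Leps (ht2.trans_le hs.1) hy fun ε hε hε1 =>
      hL ε hε hε1 s hs.1 hs.2 x y hy
  · filter_upwards [H.ae_ne x] with y hy s hs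
    exact hp.hasDerivAt (ht2.trans_le hs.1) hy

/-- Applied to `‖·‖ ^ 2`, the truncated operator only sees the second moment of the jump kernel,
because the linear term cancels by symmetry. -/
lemma HKAssumptions.setIntegral_sq_sub_le
    (H : HKAssumptions d φ J a₁ α₁ C₀ a b β κ κ₀ κ₁ κ₂ δ) (x : EuclideanSpace ℝ (Fin d))
    {ε : ℝ} (hε : 0 < ε) :
    IntegrableOn (fun z => (‖x + z‖ ^ 2 - ‖x‖ ^ 2) * (κ x z * J ‖z‖)) {z | ε < ‖z‖} ∧
    ∫ z in {z | ε < ‖z‖}, (‖x + z‖ ^ 2 - ‖x‖ ^ 2) * (κ x z * J ‖z‖)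
      ≤ κ₁ * ∫ z : EuclideanSpace ℝ (Fin d), ‖z‖ ^ 2 * J ‖z‖ := by
  have hS := measurableSet_lt_norm (d := d) ε
  have hmoment := H.integrable_sq_mul_J
  have hκ := H.κ₁_pos
  have hquad : IntegrableOn (fun z => ‖z‖ ^ 2 * (κ x z * J ‖z‖)) {z | ε < ‖z‖} := by
    refine (hmoment.integrableOn.const_mul κ₁).mono'
      ((by fun_prop : Continuous fun z : EuclideanSpace ℝ (Fin d) =>
        ‖z‖ ^ 2).aestronglyMeasurable.mul (H.aestronglyMeasurable_kernel x hε)) ?_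
    filter_upwards [ae_restrict_mem hS] with z (hz : ε < ‖z‖)
    have hk := H.kernel_nonneg x (hε.trans hz)
    rw [Real.norm_of_nonneg (by positivity), mul_left_comm κ₁]
    exact mul_le_mul_of_nonneg_left (H.kernel_le x (hε.trans hz)) (by positivity)
  have hlin : IntegrableOn (fun z => 2 * inner ℝ x z * (κ x z * J ‖z‖)) {z | ε < ‖z‖} := by
    refine (hquad.const_mul (2 * ‖x‖ / ε)).mono'
      ((by fun_prop : Continuous fun z : EuclideanSpace ℝ (Fin d) =>
        2 * inner ℝ x z).aestronglyMeasurable.mul (H.aestronglyMeasurable_kernel x hε)) ?_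
    filter_upwards [ae_restrict_mem hS] with z (hz : ε < ‖z‖)
    have hk := H.kernel_nonneg x (hε.trans hz)
    rw [norm_mul, Real.norm_of_nonneg hk, ← mul_assoc (2 * ‖x‖ / ε)]
    refine mul_le_mul_of_nonneg_right ?_ hk
    have h1 := norm_inner_le_norm (𝕜 := ℝ) x z
    rw [norm_mul, Real.norm_of_nonneg (zero_le_two (α := ℝ))]
    calc 2 * ‖inner ℝ x z‖ ≤ 2 * (‖x‖ * ‖z‖) := by gcongr
      _ ≤ 2 * (‖x‖ * ‖z‖) * (‖z‖ / ε) :=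
          le_mul_of_one_le_right (by positivity) ((one_le_div hε).2 hz.le)
      _ = _ := by ring
  have hodd : ∫ z in {z | ε < ‖z‖}, 2 * inner ℝ x z * (κ x z * J ‖z‖) = 0 := by
    rw [← integral_indicator hS]
    set F := indicator {z | ε < ‖z‖} fun z => 2 * inner ℝ x z * (κ x z * J ‖z‖) with hF
    have hneg : ∀ z, F (-z) = -F z := fun z => by
      by_cases hz : ε < ‖z‖
      · simp [hF, hz, ← H.κ_sym]
      · simp [hF, hz]
    have h1 := integral_neg_eq_self F volume
    simp_rw [hneg, integral_neg] at h1
    linarith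
  have heq : ∀ z, (‖x + z‖ ^ 2 - ‖x‖ ^ 2) * (κ x z * J ‖z‖)
      = 2 * inner ℝ x z * (κ x z * J ‖z‖) + ‖z‖ ^ 2 * (κ x z * J ‖z‖) := fun z => by
    rw [norm_add_sq_real]
    ring
  simp_rw [heq]
  refine ⟨hlin.add hquad, ?_⟩
  rw [integral_add hlin hquad, hodd, zero_add, ← integral_const_mul]
  refine (setIntegral_mono_on hquad (hmoment.integrableOn.const_mul κ₁) hS
    fun z (hz : ε < ‖z‖) => ?_).trans
    (setIntegral_le_integral (hmoment.const_mul κ₁) ?_)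
  · rw [mul_left_comm κ₁]
    exact mul_le_mul_of_nonneg_left (H.kernel_le x (hε.trans hz)) (by positivity)
  · have := H.nontrivial
    filter_upwards [Measure.ae_ne volume (0 : EuclideanSpace ℝ (Fin d))] with z hz
    have hJ := H.J_pos ‖z‖ (norm_pos_iff.2 hz)
    simp only [Pi.zero_apply]
    positivity

lemma nonneg_deriv_of_le_left {f : ℝ → ℝ} {f' s t : ℝ} (hst : s < t) (hf : HasDerivAt f f' t)
    (hle : ∀ r, s ≤ r → r ≤ t → f r ≤ f t) : 0 ≤ f' := by
  have h1 : Tendsto (slope f t) (nhdsWithin t (Iio t)) (nhds f') :=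
    hf.tendsto_slope.mono_left (nhdsWithin_mono t fun r hr => ne_of_lt hr)
  refine ge_of_tendsto h1 ?_
  filter_upwards [Ioo_mem_nhdsLT hst] with r hr
  rw [slope_def_field]
  exact div_nonneg_of_nonpos (by linarith [hle r hr.1.le hr.2.le]) (by linarith [hr.2])

/-- Maximum principle: a bounded continuous solution of the heat equation of `L^κ` whose initial
values are nonpositive is nonpositive. -/
lemma HKAssumptions.maximum_principle
    (H : HKAssumptions d φ J a₁ α₁ C₀ a b β κ κ₀ κ₁ κ₂ δ)
    {v : ℝ → EuclideanSpace ℝ (Fin d) → ℝ}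
    (hcont : ∀ t, 0 < t → ∀ x,
      ContinuousAt (fun q : ℝ × EuclideanSpace ℝ (Fin d) => v q.1 q.2) (t, x))
    (hbdd : ∀ T, ∃ B, ∀ t, 0 < t → t ≤ T → ∀ x, v t x ≤ B)
    (hinit : ∀ η, 0 < η → ∃ t₀, 0 < t₀ ∧ ∀ t, 0 < t → t < t₀ → ∀ x, v t x ≤ η)
    (hint : ∀ t, 0 < t → ∀ x ε, 0 < ε →
      IntegrableOn (fun z => (v t (x + z) - v t x) * (κ x z * J ‖z‖)) {z | ε < ‖z‖})
    (heqn : ∀ t, 0 < t → ∀ x, ∃ L, HasDerivAt (fun s => v s x) L t ∧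
      Tendsto (fun ε => Leps d κ J ε (v t) x) (nhdsWithin 0 (Ioi 0)) (nhds L))
    {T : ℝ} (hT : 0 < T) (x₀ : EuclideanSpace ℝ (Fin d)) : v T x₀ ≤ 0 := by
  by_contra! hm
  set m := v T x₀
  obtain ⟨B, hB⟩ := hbdd T
  obtain ⟨t₀, ht₀, hsmall⟩ := hinit (m / 4) (by positivity)
  set K := κ₁ * ∫ z : EuclideanSpace ℝ (Fin d), ‖z‖ ^ 2 * J ‖z‖
  set γ := m / (4 * T) with hγ_def
  have hγ : 0 < γ := by positivity
  have hγT : γ * T = m / 4 := by rw [hγ_def]; field_simp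
  obtain ⟨η, hη, hηlt⟩ := exists_between (lt_min (show 0 < m / (4 * (‖x₀‖ ^ 2 + 1)) by positivity)
    (show 0 < γ / (|K| + 1) by positivity))
  have hη1 : η * ‖x₀‖ ^ 2 ≤ m / 4 := by
    have h := (hηlt.trans_le (min_le_left _ _)).le
    rw [le_div_iff₀ (by positivity)] at h
    linarith
  have hη2 : η * K < γ := by
    have h := hηlt.trans_le (min_le_right _ _)
    rw [lt_div_iff₀ (by positivity)] at h
    have := mul_le_mul_of_nonneg_left (le_abs_self K) hη.le
    linarith
  set t₁ := min (t₀ / 2) T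
  have ht₁ : 0 < t₁ := by positivity
  have ht₁T : t₁ ≤ T := min_le_right _ _
  have ht₁t₀ : t₁ < t₀ := (min_le_left _ _).trans_lt (by linarith)
  obtain ⟨R, hR, hBR⟩ : ∃ R : ℝ, ‖x₀‖ ≤ R ∧ B ≤ η * R ^ 2 := by
    refine ⟨‖x₀‖ + (|B| / η + 1), by linarith [show 0 ≤ |B| / η by positivity], ?_⟩
    have h1 : |B| / η ≤ (‖x₀‖ + (|B| / η + 1)) ^ 2 := by
      have : 0 ≤ |B| / η := by positivity
      nlinarith [norm_nonneg x₀]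
    rw [div_le_iff₀ hη] at h1
    linarith [le_abs_self B]
  let w : ℝ × EuclideanSpace ℝ (Fin d) → ℝ := fun q => v q.1 q.2 - η * ‖q.2‖ ^ 2 - γ * q.1
  have hw : ContinuousOn w (Icc t₁ T ×ˢ Metric.closedBall 0 R) := by
    rintro ⟨t, x⟩ ⟨ht, -⟩
    have h1 := hcont t (ht₁.trans_le ht.1) x
    have h2 : ContinuousAt (fun q : ℝ × EuclideanSpace ℝ (Fin d) => η * ‖q.2‖ ^ 2) (t, x) := by
      fun_prop
    have h3 : ContinuousAt (fun q : ℝ × EuclideanSpace ℝ (Fin d) => γ * q.1) (t, x) := by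
      fun_prop
    exact ((h1.sub h2).sub h3).continuousWithinAt
  have hmem : (T, x₀) ∈ Icc t₁ T ×ˢ Metric.closedBall (0 : EuclideanSpace ℝ (Fin d)) R :=
    ⟨⟨ht₁T, le_rfl⟩, by simpa using hR⟩
  obtain ⟨⟨τ, ξ⟩, ⟨hτ, hξ⟩, hmax⟩ := (isCompact_Icc.prod
    (isCompact_closedBall (0 : EuclideanSpace ℝ (Fin d)) R)).exists_isMaxOn ⟨_, hmem⟩ hw
  have hτ0 : 0 < τ := ht₁.trans_le hτ.1
  have hstart : m / 2 ≤ w (τ, ξ) := by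
    have h1 : w (T, x₀) ≤ w (τ, ξ) := hmax hmem
    have h2 : w (T, x₀) = m - η * ‖x₀‖ ^ 2 - γ * T := rfl
    linarith
  have hglobal : ∀ t x, t₁ ≤ t → t ≤ T → w (t, x) ≤ w (τ, ξ) := by
    intro t x ht htT
    by_cases hx : ‖x‖ ≤ R
    · exact hmax ⟨⟨ht, htT⟩, by simpa using hx⟩
    · have h1 := hB t (ht₁.trans_le ht) htT x
      have h2 : w (t, x) = v t x - η * ‖x‖ ^ 2 - γ * t := rfl
      have hR0 : 0 ≤ R := (norm_nonneg _).trans hR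
      have h3 : η * R ^ 2 ≤ η * ‖x‖ ^ 2 := by
        have := (not_le.1 hx).le
        gcongr
      have h4 : 0 ≤ γ * t := mul_nonneg hγ.le (ht₁.le.trans ht)
      linarith
  have hw_def : w (τ, ξ) = v τ ξ - η * ‖ξ‖ ^ 2 - γ * τ := rfl
  have hτ1 : t₁ < τ := by
    refine lt_of_le_of_ne hτ.1 fun h => ?_
    have h1 := hsmall τ hτ0 (h ▸ ht₁t₀) ξ
    have h2 : 0 ≤ η * ‖ξ‖ ^ 2 := by positivity
    have h3 : 0 ≤ γ * τ := by positivity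
    linarith
  obtain ⟨L, hderiv, hL⟩ := heqn τ hτ0 ξ
  have hLγ : γ ≤ L := by
    have hd : HasDerivAt (fun s => v s ξ - γ * s) (L - γ) τ := by
      simpa using hderiv.fun_sub ((hasDerivAt_id τ).const_mul γ)
    have := nonneg_deriv_of_le_left hτ1 hd fun r hr hrτ => by
      have h1 := hglobal r ξ hr (hrτ.trans hτ.2)
      have h2 : w (r, ξ) = v r ξ - η * ‖ξ‖ ^ 2 - γ * r := rfl
      linarith
    linarith
  have hLK : L ≤ η * K := by
    refine le_of_tendsto hL ?_
    filter_upwards [self_mem_nhdsWithin] with ε hε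
    obtain ⟨hi, hle⟩ := H.setIntegral_sq_sub_le ξ hε
    calc Leps d κ J ε (v τ) ξ
        ≤ ∫ z in {z | ε < ‖z‖}, η * ((‖ξ + z‖ ^ 2 - ‖ξ‖ ^ 2) * (κ ξ z * J ‖z‖)) := by
          refine setIntegral_mono_on (hint τ hτ0 ξ ε hε) (hi.const_mul η)
            (measurableSet_lt_norm ε) fun z hz => ?_
          rw [← mul_assoc η]
          refine mul_le_mul_of_nonneg_right ?_ (H.kernel_nonneg ξ (lt_trans hε hz))
          have h1 := hglobal τ (ξ + z) hτ.1 hτ.2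
          have h2 : w (τ, ξ + z) = v τ (ξ + z) - η * ‖ξ + z‖ ^ 2 - γ * τ := rfl
          linarith
      _ ≤ η * K := by
          rw [integral_const_mul]
          gcongr
  linarith

end Bounds

/-- conservativeness of the good heat kernel. -/
theorem heat_kernel_conservative
    (d : ℕ) (φ J : ℝ → ℝ) (a₁ α₁ C₀ a b β : ℝ)
    (κ : EuclideanSpace ℝ (Fin d) → EuclideanSpace ℝ (Fin d) → ℝ)
    (κ₀ κ₁ κ₂ δ : ℝ)
    (H : HKAssumptions d φ J a₁ α₁ C₀ a b β κ κ₀ κ₁ κ₂ δ)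
    (Φinv : ℝ → ℝ) (HΦ : PhiInvSpec φ Φinv)
    (p : ℝ → EuclideanSpace ℝ (Fin d) → EuclideanSpace ℝ (Fin d) → ℝ)
    (hp : GoodHeatKernel d φ J b β Φinv κ p) :
    ∀ t : ℝ, 0 < t → ∀ x : EuclideanSpace ℝ (Fin d), (∫ y, p t x y) = 1 := by
  have hLeps : ∀ (σ ε t : ℝ) (x : EuclideanSpace ℝ (Fin d)),
      Leps d κ J ε (fun x' => σ * ((∫ y, p t x' y) - 1)) x
        = σ * Leps d κ J ε (fun x' => ∫ y, p t x' y) x := by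
    intro σ ε t x
    unfold Leps
    rw [← integral_const_mul]
    congr 1 with z
    ring
  have key : ∀ σ : ℝ, |σ| = 1 → ∀ t : ℝ, 0 < t → ∀ x : EuclideanSpace ℝ (Fin d),
      σ * ((∫ y, p t x y) - 1) ≤ 0 := by
    intro σ hσ t ht x
    have hle : ∀ r : ℝ, σ * r ≤ |r| := fun r => by
      simpa [abs_mul, hσ] using le_abs_self (σ * r)
    refine H.maximum_principle (v := fun t x => σ * ((∫ y, p t x y) - 1)) ?_ ?_ ?_ ?_ ?_ ht x
    · intro t ht x
      exact ((hp.continuousAt_integral H ht x).sub continuousAt_const).const_mul σ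
    · intro T
      obtain ⟨B, hB⟩ := hp.abs_integral_le H HΦ T
      refine ⟨B + 1, fun t ht htT x => (hle _).trans ((abs_sub _ _).trans ?_)⟩
      simpa using hB t ht htT x
    · intro η hη
      obtain ⟨t₀, ht₀, happ⟩ := hp.approx (fun _ => 1) ⟨1, by simp⟩ uniformContinuous_const η hη
      refine ⟨t₀, ht₀, fun t ht htt x => (hle _).trans ?_⟩
      simpa using happ t ht htt x
    · intro t ht x ε hε
      refine ((hp.integrableOn_integral_sub H HΦ ht x hε).const_mul σ).congr
        (Eventually.of_forall fun z => ?_)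
      ring
    · intro t ht x
      refine ⟨σ * ∫ y, deriv (fun s => p s x y) t,
        ((hp.hasDerivAt_integral H HΦ ht x).sub_const 1).const_mul σ, ?_⟩
      simp_rw [hLeps]
      exact (hp.tendsto_Leps_integral H HΦ ht x).const_mul σ
  intro t ht x
  have h1 := key 1 (by simp) t ht x
  have h2 := key (-1) (by simp) t ht x
  linarith
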